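/- Let s > 0 and 0 ≤ ε < min{s, 3/4}, and set γ = max{1/4 + (ε−s)/2, ε − 1/2, 0}. Then there exists a constant C > 0 such that for every ξ > 1, every α ∈ ℝ and every M > 1, the frequency-restricted cubic resonance integral satisfies ∫∫_{{(ξ₁,ξ₂) ∈ ℝ² : ξ₁ > ξ}} [⟨ξ⟩^{2s+2ε+2} (ξ₂+ξ₃)² / (ξ₁² ⟨ξ₁⟩^{2s} ⟨ξ₂⟩^{2s+2} ⟨ξ₃⟩^{2s})] · 1_{|Φ(ξ,ξ₁,ξ₂) − α| < M} dξ₁ dξ₂ ≤ C (|α| + M)^{2γ} M. -/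

import Mathlib

open MeasureTheory Real
open scoped ENNReal

/-- Japanese bracket `⟨ξ⟩ = (1+ξ²)^{1/2}`. -/
noncomputable def jap (ξ : ℝ) : ℝ := Real.sqrt (1 + ξ ^ 2)

/-- Cubic resonance function of the gauged Benjamin–Ono equation,
with `ξ₃ = ξ - ξ₁ - ξ₂`. -/
noncomputable def Φbo (ξ ξ₁ ξ₂ : ℝ) : ℝ :=
  |ξ| * ξ - |ξ₁| * ξ₁ + |ξ₂| * ξ₂ - |ξ - ξ₁ - ξ₂| * (ξ - ξ₁ - ξ₂)

theorem one_le_jap (x : ℝ) : 1 ≤ jap x := by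
  unfold jap
  rw [Real.one_le_sqrt]
  nlinarith [sq_nonneg x]

theorem jap_pos (x : ℝ) : 0 < jap x := one_pos.trans_le (one_le_jap x)

theorem abs_le_jap (x : ℝ) : |x| ≤ jap x := Real.abs_le_sqrt (by linarith)

theorem jap_le_mul {k x y : ℝ} (hk : 1 ≤ k) (h : |x| ≤ k * |y|) : jap x ≤ k * jap y := by
  unfold jap
  apply Real.sqrt_le_iff.2
  refine ⟨by positivity, ?_⟩
  rw [mul_pow, Real.sq_sqrt (by positivity)]
  have h2 : x ^ 2 ≤ k ^ 2 * y ^ 2 := by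
    rw [← sq_abs x, ← sq_abs y, ← mul_pow]
    gcongr
  nlinarith

theorem jap_le_jap {x y : ℝ} (h : |x| ≤ |y|) : jap x ≤ jap y := by
  simpa using jap_le_mul (k := 1) le_rfl (by simpa using h)

theorem jap_le_one_add_abs (x : ℝ) : jap x ≤ 1 + |x| := by
  unfold jap
  apply Real.sqrt_le_iff.2
  exact ⟨by positivity, by nlinarith [sq_abs x, abs_nonneg x]⟩

theorem continuous_jap : Continuous jap := by
  unfold jap
  fun_prop

theorem continuous_Φbo (ξ : ℝ) : Continuous fun z : ℝ × ℝ => Φbo ξ z.1 z.2 := by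
  unfold Φbo
  fun_prop

/-- The weight `⟨t⟩^{-1-2s}` is integrable for `s > 0`. -/
theorem lintegral_jap_rpow_lt_top {s : ℝ} (hs : 0 < s) :
    ∫⁻ t : ℝ, ENNReal.ofReal (jap t ^ (-(1 + 2 * s))) < ⊤ := by
  have h : Integrable (fun x : ℝ => (1 + ‖x‖ ^ 2) ^ (-(1 + 2 * s) / 2)) :=
    integrable_rpow_neg_one_add_norm_sq (by simp; linarith)
  have h2 : (fun x : ℝ => (1 + ‖x‖ ^ 2) ^ (-(1 + 2 * s) / 2)) =
      fun t => jap t ^ (-(1 + 2 * s)) := by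
    ext x
    unfold jap
    rw [Real.sqrt_eq_rpow, ← Real.rpow_mul (by positivity), Real.norm_eq_abs, sq_abs]
    congr 1
    ring
  rw [h2] at h
  exact h.lintegral_lt_top

/-- If the horizontal sections of `S` have length at most `L / D t`, then a density
`D t * g t` on `S` has total mass at most `L ∫ g`. -/
theorem lintegral_indicator_le_of_sections {S : Set (ℝ × ℝ)} (hS : MeasurableSet S)
    {D g : ℝ → ℝ} (hD : Measurable D) (hg : Measurable g) (hD0 : ∀ t, 0 < D t)
    (hg0 : ∀ t, 0 ≤ g t) {L : ℝ}
    (hL : ∀ x y t, (x, t) ∈ S → (y, t) ∈ S → D t * |x - y| ≤ L) :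
    ∫⁻ x : ℝ, ∫⁻ t : ℝ, S.indicator (fun z => ENNReal.ofReal (D z.2 * g z.2)) (x, t) ≤
      ENNReal.ofReal L * ∫⁻ t, ENNReal.ofReal (g t) := by
  have hm : Measurable (S.indicator fun z : ℝ × ℝ => ENNReal.ofReal (D z.2 * g z.2)) :=
    Measurable.indicator (by fun_prop) hS
  rw [lintegral_lintegral_swap (f := fun x t => S.indicator
    (fun z => ENNReal.ofReal (D z.2 * g z.2)) (x, t)) hm.aemeasurable,
    ← lintegral_const_mul' _ _ ENNReal.ofReal_ne_top]
  refine lintegral_mono fun t => ?_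
  have hsec : MeasurableSet {x | (x, t) ∈ S} := hS.preimage measurable_prodMk_right
  have e : ∀ x, S.indicator (fun z : ℝ × ℝ => ENNReal.ofReal (D z.2 * g z.2)) (x, t) =
      {x | (x, t) ∈ S}.indicator (fun _ => ENNReal.ofReal (D t * g t)) x := fun x => by
    by_cases h : (x, t) ∈ S <;> simp [h]
  simp_rw [e]
  rw [lintegral_indicator_const hsec]
  have hv : volume {x | (x, t) ∈ S} ≤ ENNReal.ofReal (L / D t) := by
    refine (Real.volume_le_diam _).trans (Metric.ediam_le fun x hx y hy => ?_)
    rw [edist_dist, Real.dist_eq]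
    apply ENNReal.ofReal_le_ofReal
    rw [le_div_iff₀ (hD0 t), mul_comm]
    exact hL x y t hx hy
  calc ENNReal.ofReal (D t * g t) * volume {x | (x, t) ∈ S}
      ≤ ENNReal.ofReal (D t * g t) * ENNReal.ofReal (L / D t) := by gcongr
    _ = ENNReal.ofReal (L * g t) := by
        rw [← ENNReal.ofReal_mul (mul_nonneg (hD0 t).le (hg0 t))]
        congr 1
        field_simp [(hD0 t).ne']
    _ = ENNReal.ofReal L * ENNReal.ofReal (g t) := ENNReal.ofReal_mul' (hg0 t)

theorem rpow_weight_le {s ε γ ξ w : ℝ} (hε : 0 ≤ ε) (hεs : ε ≤ s) (hγ0 : 0 ≤ γ)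
    (hγ1 : 2 * ε - 1 ≤ 2 * γ) (hγ2 : 2 * ε + 1 - 2 * s ≤ 4 * γ) (hε1 : ε ≤ 3 / 4)
    (hξ : 1 < ξ) (hw : 0 < w) :
    ξ ^ (2 * s + 2 * ε + 2) * w ^ 2 ≤ ξ * (1 + ξ * w) ^ (2 * γ) *
      (max ξ w ^ 2 * max ξ w ^ (2 * s) * max 1 w ^ (2 * s)) := by
  have hξ0 : 0 < ξ := by linarith
  obtain ⟨u, rfl⟩ : ∃ u, ξ = Real.exp u := ⟨Real.log ξ, (Real.exp_log hξ0).symm⟩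
  obtain ⟨v, rfl⟩ : ∃ v, w = Real.exp v := ⟨Real.log w, (Real.exp_log hw).symm⟩
  have hu : 0 < u := by simpa using hξ
  have h1 : Real.exp (max 0 (u + v)) ≤ 1 + Real.exp u * Real.exp v := by
    rw [← Real.exp_add]
    rcases max_cases 0 (u + v) with ⟨h, -⟩ | ⟨h, -⟩ <;> rw [h]
    · simpa using (Real.exp_pos (u + v)).le
    · simp
  have e1 : max (Real.exp u) (Real.exp v) = Real.exp (max u v) :=
    (Real.exp_monotone.map_max).symm
  have e2 : max 1 (Real.exp v) = Real.exp (max 0 v) := by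
    rw [Real.exp_monotone.map_max, Real.exp_zero]
  have e3 : Real.exp (max 0 (u + v)) ^ (2 * γ) ≤ (1 + Real.exp u * Real.exp v) ^ (2 * γ) := by
    gcongr
  refine le_trans ?_ (mul_le_mul_of_nonneg_right
    (mul_le_mul_of_nonneg_left e3 (Real.exp_pos u).le) (by positivity))
  rw [e1, e2]
  simp only [← Real.rpow_natCast, ← Real.exp_mul, ← Real.exp_add, Real.exp_le_exp]
  push_cast
  rcases le_total v 0 with hv | hv
  · rw [max_eq_left hv, max_eq_left (by linarith : v ≤ u)]
    have hm : (2 * ε - 1) * u + 2 * v ≤ max 0 (u + v) * (2 * γ) := by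
      rcases le_total ε (1 / 2) with h | h
      · have := mul_nonneg (le_max_left 0 (u + v)) (by positivity : 0 ≤ 2 * γ)
        nlinarith
      · have := mul_le_mul_of_nonneg_left hγ1 (le_max_left 0 (u + v))
        have := mul_le_mul_of_nonneg_right (le_max_right 0 (u + v))
          (by linarith : 0 ≤ 2 * ε - 1)
        nlinarith
    nlinarith
  · rw [max_eq_right hv, max_eq_right (by linarith : 0 ≤ u + v)]
    rcases le_total v u with h | h
    · rw [max_eq_left h]
      nlinarith [mul_nonneg (sub_nonneg.2 h) (sub_nonneg.2 hγ1),
        mul_nonneg hv (sub_nonneg.2 hγ2)]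
    · rw [max_eq_right h]
      have hs : 0 ≤ s := hε.trans hεs
      nlinarith [mul_nonneg (sub_nonneg.2 h) hs, mul_nonneg (sub_nonneg.2 h) hγ0,
        mul_nonneg hu.le (sub_nonneg.2 hγ2)]

theorem jap_weight_le {s ε γ ξ w : ℝ} (hε : 0 ≤ ε) (hεs : ε ≤ s) (hγ0 : 0 ≤ γ)
    (hγ1 : 2 * ε - 1 ≤ 2 * γ) (hγ2 : 2 * ε + 1 - 2 * s ≤ 4 * γ) (hε1 : ε ≤ 3 / 4)
    (hξ : 1 < ξ) (hw : 0 < w) :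
    jap ξ ^ (2 * s + 2 * ε + 2) * w ^ 2 ≤
      2 ^ (2 * s + 2 * ε + 2) * (ξ * (1 + ξ * w) ^ (2 * γ)) *
      ((ξ + w) ^ 2 * jap (ξ + w) ^ (2 * s) * jap w ^ (2 * s)) := by
  have hs : 0 ≤ s := hε.trans hεs
  have hX : jap ξ ≤ 2 * ξ := by
    have := jap_le_one_add_abs ξ
    rw [abs_of_pos (by linarith)] at this
    linarith
  have hP : max ξ w ≤ ξ + w := max_le (by linarith) (by linarith)
  have hJP : max ξ w ≤ jap (ξ + w) := hP.trans ((le_abs_self _).trans (abs_le_jap _))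
  have hJw : max 1 w ≤ jap w := max_le (one_le_jap w) ((le_abs_self _).trans (abs_le_jap _))
  have hm : 0 < max ξ w := lt_max_of_lt_right hw
  have hm1 : 0 < max 1 w := lt_max_of_lt_right hw
  have hJ := jap_pos ξ
  calc jap ξ ^ (2 * s + 2 * ε + 2) * w ^ 2 ≤ (2 * ξ) ^ (2 * s + 2 * ε + 2) * w ^ 2 := by
        gcongr
    _ = 2 ^ (2 * s + 2 * ε + 2) * (ξ ^ (2 * s + 2 * ε + 2) * w ^ 2) := by
        rw [Real.mul_rpow (by norm_num) (by linarith)]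
        ring
    _ ≤ 2 ^ (2 * s + 2 * ε + 2) * (ξ * (1 + ξ * w) ^ (2 * γ) *
          (max ξ w ^ 2 * max ξ w ^ (2 * s) * max 1 w ^ (2 * s))) := by
        exact mul_le_mul_of_nonneg_left (rpow_weight_le hε hεs hγ0 hγ1 hγ2 hε1 hξ hw)
          (by positivity)
    _ ≤ 2 ^ (2 * s + 2 * ε + 2) * (ξ * (1 + ξ * w) ^ (2 * γ) *
          ((ξ + w) ^ 2 * jap (ξ + w) ^ (2 * s) * jap w ^ (2 * s))) := by
        have : 0 < jap (ξ + w) := jap_pos _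
        gcongr
    _ = _ := by ring

theorem rpow_le_of_le_right_factor {s a b c : ℝ} (hs : 0 ≤ s) (ha : 1 ≤ a) (hb : 1 ≤ b)
    (hc : 1 ≤ c) (h : c ≤ 2 * b) :
    c ^ (2 * s) ≤ 2 ^ (2 * s) * a ^ (-(1 + 2 * s)) * (a ^ (2 * s + 2) * b ^ (2 * s)) := by
  have ha0 : 0 < a := by linarith
  have hb0 : 0 < b := by linarith
  have e : a ^ (-(1 + 2 * s)) * a ^ (2 * s + 2) = a := by
    rw [← Real.rpow_add ha0]
    ring_nf
    simp
  calc c ^ (2 * s) ≤ (2 * b) ^ (2 * s) := by gcongr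
    _ = 2 ^ (2 * s) * b ^ (2 * s) := Real.mul_rpow (by norm_num) hb0.le
    _ ≤ 2 ^ (2 * s) * b ^ (2 * s) * a := le_mul_of_one_le_right (by positivity) ha
    _ = 2 ^ (2 * s) * b ^ (2 * s) * (a ^ (-(1 + 2 * s)) * a ^ (2 * s + 2)) := by rw [e]
    _ = _ := by ring

theorem rpow_le_of_le_left_factor {s a b c : ℝ} (hs : 0 ≤ s) (ha : 1 ≤ a) (hb : 1 ≤ b)
    (hc : 1 ≤ c) (h : c ≤ 2 * a) (hba : b ≤ a) :
    c ^ (2 * s) ≤ 2 ^ (2 * s) * b ^ (-(1 + 2 * s)) * (a ^ (2 * s + 2) * b ^ (2 * s)) := by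
  have ha0 : 0 < a := by linarith
  have hb0 : 0 < b := by linarith
  have e : b ^ (-(1 + 2 * s)) * b ^ (2 * s) = b⁻¹ := by
    rw [← Real.rpow_add hb0, ← Real.rpow_neg_one]
    ring_nf
  have e2 : a ^ (2 * s + 2) = a ^ (2 * s) * a ^ 2 := by
    rw [Real.rpow_add ha0]
    norm_num
  have e3 : 1 ≤ a ^ 2 * b⁻¹ := by
    rw [← div_eq_mul_inv, one_le_div hb0]
    nlinarith
  calc c ^ (2 * s) ≤ (2 * a) ^ (2 * s) := by gcongr
    _ = 2 ^ (2 * s) * a ^ (2 * s) := Real.mul_rpow (by norm_num) ha0.le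
    _ ≤ 2 ^ (2 * s) * a ^ (2 * s) * (a ^ 2 * b⁻¹) := le_mul_of_one_le_right (by positivity) e3
    _ = 2 ^ (2 * s) * a ^ (2 * s) * (a ^ 2 * (b ^ (-(1 + 2 * s)) * b ^ (2 * s))) := by rw [e]
    _ = _ := by rw [e2]; ring

/-- The weight bound when the second frequency is comparable to the output frequency. -/
theorem weight_le_of_large {s ε X P p w a b : ℝ} (hε : 0 ≤ ε) (hεs : ε ≤ s) (hX : 1 ≤ X)
    (ha : 1 ≤ a) (hb : 1 ≤ b) (hXP : X ≤ P) (hXa : X ≤ 4 * a) (hw : 0 ≤ w) (hwp : w ≤ p) :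
    X ^ (2 * s + 2 * ε + 2) * w ^ 2 ≤ 4 ^ (2 * s + 2) * (b * b ^ (-(1 + 2 * s))) *
      (p ^ 2 * P ^ (2 * s) * a ^ (2 * s + 2) * b ^ (2 * s)) := by
  have hs : 0 ≤ s := hε.trans hεs
  have hX0 : 0 < X := by linarith
  have hb0 : 0 < b := by linarith
  have hP0 : 0 < P := by linarith
  have e : b * b ^ (-(1 + 2 * s)) * b ^ (2 * s) = 1 := by
    nth_rewrite 1 [← Real.rpow_one b]
    rw [← Real.rpow_add hb0, ← Real.rpow_add hb0]
    ring_nf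
    simp
  calc X ^ (2 * s + 2 * ε + 2) * w ^ 2 = X ^ (2 * s + 2) * X ^ (2 * ε) * w ^ 2 := by
        rw [← Real.rpow_add hX0]
        ring_nf
    _ ≤ (4 * a) ^ (2 * s + 2) * P ^ (2 * s) * p ^ 2 := by
        have : X ^ (2 * ε) ≤ P ^ (2 * s) :=
          (Real.rpow_le_rpow_of_exponent_le hX (by linarith : 2 * ε ≤ 2 * s)).trans (by gcongr)
        gcongr
    _ = 4 ^ (2 * s + 2) * a ^ (2 * s + 2) * P ^ (2 * s) * p ^ 2 *
          (b * b ^ (-(1 + 2 * s)) * b ^ (2 * s)) := by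
        rw [e, mul_one, Real.mul_rpow (by norm_num) (by linarith)]
    _ = _ := by ring

/-- The weight bound near the resonant set, where `ξ w ≲ q²`. -/
theorem weight_le_of_resonant {s ε ξ X P p w q a b : ℝ} (hε : 0 ≤ ε) (hεs : ε ≤ s)
    (hε1 : ε ≤ 3 / 4) (hξ : 1 < ξ) (hX : 1 ≤ X) (hX2 : X ≤ 2 * ξ) (hp : ξ ≤ p) (hXP : X ≤ P)
    (ha : 1 ≤ a) (hab : a ≤ b) (haX : a ≤ X) (hw : 0 ≤ w) (hq : |q| ≤ a)
    (hwq : ξ * w ≤ 4 * q ^ 2) :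
    X ^ (2 * s + 2 * ε + 2) * w ^ 2 ≤ 512 * (ξ * a ^ (-(1 + 2 * s))) *
      (p ^ 2 * P ^ (2 * s) * a ^ (2 * s + 2) * b ^ (2 * s)) := by
  have hs : 0 ≤ s := hε.trans hεs
  have hX0 : 0 < X := by linarith
  have ha0 : 0 < a := by linarith
  have hb0 : 0 < b := by linarith
  have hP0 : 0 < P := by linarith
  have hξ0 : 0 < ξ := by linarith
  have e : a ^ (-(1 + 2 * s)) * a ^ (2 * s + 2) = a := by
    rw [← Real.rpow_add ha0]
    ring_nf
    simp
  have hq2 : q ^ 2 ≤ a ^ 2 := by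
    rw [← sq_abs q]
    gcongr
  have h1 : (ξ * w) ^ 2 ≤ 16 * a ^ 4 :=
    calc (ξ * w) ^ 2 ≤ (4 * a ^ 2) ^ 2 :=
        pow_le_pow_left₀ (by positivity) (by linarith) 2
      _ = 16 * a ^ 4 := by ring
  have h2 : a ^ 4 ≤ a * a ^ (2 * s) * X ^ (3 - 2 * ε) :=
    calc a ^ 4 = a * a ^ (2 * s) * a ^ (3 - 2 * s) := by
          nth_rewrite 2 [← Real.rpow_one a]
          rw [← Real.rpow_add ha0, ← Real.rpow_add ha0, ← Real.rpow_natCast]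
          norm_num
      _ ≤ a * a ^ (2 * s) * X ^ (3 - 2 * ε) := by
          have : a ^ (3 - 2 * s) ≤ X ^ (3 - 2 * ε) :=
            (Real.rpow_le_rpow_of_exponent_le ha (by linarith : 3 - 2 * s ≤ 3 - 2 * ε)).trans
              (Real.rpow_le_rpow ha0.le haX (by linarith))
          gcongr
  have h3 : X ^ (2 * s + 2 * ε + 2) * X ^ (3 - 2 * ε) = X ^ (2 * s) * X ^ 5 := by
    rw [← Real.rpow_add hX0, ← Real.rpow_natCast, ← Real.rpow_add hX0]
    push_cast
    ring_nf
  have h4 : X ^ 5 ≤ 32 * ξ ^ 5 :=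
    calc X ^ 5 ≤ (2 * ξ) ^ 5 := by gcongr
      _ = 32 * ξ ^ 5 := by ring
  have key : ξ ^ 2 * (X ^ (2 * s + 2 * ε + 2) * w ^ 2) ≤
      ξ ^ 2 * (512 * ξ * a * (ξ ^ 2 * X ^ (2 * s) * a ^ (2 * s))) :=
    calc ξ ^ 2 * (X ^ (2 * s + 2 * ε + 2) * w ^ 2)
        = X ^ (2 * s + 2 * ε + 2) * (ξ * w) ^ 2 := by ring
      _ ≤ X ^ (2 * s + 2 * ε + 2) * (16 * (a * a ^ (2 * s) * X ^ (3 - 2 * ε))) := by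
          gcongr
          linarith
      _ = 16 * a * a ^ (2 * s) * (X ^ (2 * s + 2 * ε + 2) * X ^ (3 - 2 * ε)) := by ring
      _ = 16 * a * a ^ (2 * s) * (X ^ (2 * s) * X ^ 5) := by rw [h3]
      _ ≤ 16 * a * a ^ (2 * s) * (X ^ (2 * s) * (32 * ξ ^ 5)) := by gcongr
      _ = _ := by ring
  calc X ^ (2 * s + 2 * ε + 2) * w ^ 2
      ≤ 512 * ξ * a * (ξ ^ 2 * X ^ (2 * s) * a ^ (2 * s)) :=
        le_of_mul_le_mul_left key (by positivity)
    _ ≤ 512 * ξ * a * (p ^ 2 * P ^ (2 * s) * b ^ (2 * s)) := by gcongr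
    _ = 512 * ξ * (a ^ (-(1 + 2 * s)) * a ^ (2 * s + 2)) *
          (p ^ 2 * P ^ (2 * s) * b ^ (2 * s)) := by rw [e]
    _ = _ := by ring

theorem Φbo_of_nonpos_of_nonpos {ξ p q : ℝ} (hξ : 0 ≤ ξ) (hp : 0 ≤ p) (hq : q ≤ 0)
    (hr : ξ - p - q ≤ 0) : Φbo ξ p q = -2 * (p - ξ) * (ξ - q) := by
  unfold Φbo
  rw [abs_of_nonneg hξ, abs_of_nonneg hp, abs_of_nonpos hq, abs_of_nonpos hr]
  ring

theorem Φbo_of_nonneg_of_nonpos {ξ p q : ℝ} (hξ : 0 ≤ ξ) (hp : 0 ≤ p) (hq : 0 ≤ q)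
    (hr : ξ - p - q ≤ 0) : Φbo ξ p q = 2 * (q ^ 2 + (p - ξ) * q - ξ * (p - ξ)) := by
  unfold Φbo
  rw [abs_of_nonneg hξ, abs_of_nonneg hp, abs_of_nonneg hq, abs_of_nonpos hr]
  ring

theorem Φbo_of_nonpos_of_nonneg {ξ p q : ℝ} (hξ : 0 ≤ ξ) (hp : 0 ≤ p) (hq : q ≤ 0)
    (hr : 0 ≤ ξ - p - q) :
    Φbo ξ p q = -(2 * ξ * (p - ξ) + (p - ξ) ^ 2 + q ^ 2 + (ξ - p - q) ^ 2) := by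
  unfold Φbo
  rw [abs_of_nonneg hξ, abs_of_nonneg hp, abs_of_nonpos hq, abs_of_nonneg hr]
  ring

/-- The integrand of the cubic resonance integral on the support of its cutoff. -/
noncomputable def cubicWeight (s ε ξ p q : ℝ) : ℝ :=
  jap ξ ^ (2 * s + 2 * ε + 2) * (q + (ξ - p - q)) ^ 2 /
    (p ^ 2 * jap p ^ (2 * s) * jap q ^ (2 * s + 2) * jap (ξ - p - q) ^ (2 * s))

theorem cubicWeight_le {s ε ξ p q B : ℝ} (hp : 0 < p)
    (h : jap ξ ^ (2 * s + 2 * ε + 2) * (p - ξ) ^ 2 ≤ B *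
      (p ^ 2 * jap p ^ (2 * s) * jap q ^ (2 * s + 2) * jap (ξ - p - q) ^ (2 * s))) :
    cubicWeight s ε ξ p q ≤ B := by
  have := jap_pos p
  have := jap_pos q
  have := jap_pos (ξ - p - q)
  unfold cubicWeight
  rw [div_le_iff₀ (by positivity)]
  rwa [show q + (ξ - p - q) = -(p - ξ) by ring, neg_sq]

/-- The weight bound away from the resonant set, where `ξ w ≲ |α| + M`. -/
theorem cubicWeight_le_of_nonresonant {s ε γ ξ p q N G : ℝ} (hε : 0 ≤ ε) (hεs : ε ≤ s)
    (hγ0 : 0 ≤ γ) (hγ1 : 2 * ε - 1 ≤ 2 * γ) (hγ2 : 2 * ε + 1 - 2 * s ≤ 4 * γ)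
    (hε1 : ε ≤ 3 / 4) (hξ : 1 < ξ) (hp : ξ < p) (hN : 1 + ξ * (p - ξ) ≤ 2 * N)
    (h : jap (p - ξ) ^ (2 * s) ≤
      2 ^ (2 * s) * G * (jap q ^ (2 * s + 2) * jap (ξ - p - q) ^ (2 * s))) :
    cubicWeight s ε ξ p q ≤
      2 ^ (2 * s + 2 * ε + 2) * 2 ^ (2 * γ) * 2 ^ (2 * s) * N ^ (2 * γ) * (ξ * G) := by
  have hw : 0 < p - ξ := by linarith
  have hN0 : 0 ≤ N := by nlinarith
  have hJp := jap_pos p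
  have := jap_pos (p - ξ)
  apply cubicWeight_le (by linarith)
  have h1 := jap_weight_le hε hεs hγ0 hγ1 hγ2 hε1 hξ hw
  rw [add_sub_cancel] at h1
  refine h1.trans ?_
  calc 2 ^ (2 * s + 2 * ε + 2) * (ξ * (1 + ξ * (p - ξ)) ^ (2 * γ)) *
        (p ^ 2 * jap p ^ (2 * s) * jap (p - ξ) ^ (2 * s))
      ≤ 2 ^ (2 * s + 2 * ε + 2) * (ξ * (2 * N) ^ (2 * γ)) * (p ^ 2 * jap p ^ (2 * s) *
        (2 ^ (2 * s) * G * (jap q ^ (2 * s + 2) * jap (ξ - p - q) ^ (2 * s)))) := by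
        gcongr
    _ = _ := by
        rw [Real.mul_rpow (by norm_num) hN0]
        ring

/-- A constant dominating the weight in all frequency regions. -/
noncomputable def cubicConst (s ε γ : ℝ) : ℝ :=
  2 ^ (2 * s + 2 * ε + 2) * 2 ^ (2 * γ) * 2 ^ (2 * s) + 4 ^ (2 * s + 2) + 512

theorem cubicConst_pos (s ε γ : ℝ) : 0 < cubicConst s ε γ := by
  unfold cubicConst
  positivity

/-- On the support of the cutoff the weight is controlled, in each frequency region, by an
integrable function of `ξ₂` or of `ξ₃` times a lower bound for the derivative of the phase. -/
theorem cubicWeight_trichotomy {s ε γ ξ α M p q : ℝ} (hε : 0 ≤ ε) (hεs : ε ≤ s)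
    (hγ0 : 0 ≤ γ) (hγ1 : 2 * ε - 1 ≤ 2 * γ) (hγ2 : 2 * ε + 1 - 2 * s ≤ 4 * γ)
    (hε1 : ε ≤ 3 / 4) (hξ : 1 < ξ) (hM : 1 < M) (hp : ξ < p) (hΦ : |Φbo ξ p q - α| < M) :
    (q ≤ ξ / 4 ∧ ξ - p - q ≤ 0 ∧ cubicWeight s ε ξ p q ≤
      cubicConst s ε γ * (|α| + M) ^ (2 * γ) * (ξ * jap q ^ (-(1 + 2 * s)))) ∨
    (cubicWeight s ε ξ p q ≤ cubicConst s ε γ * (|α| + M) ^ (2 * γ) *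
      (ξ * jap (ξ - p - q) ^ (-(1 + 2 * s)))) ∨
    (0 ≤ q ∧ ξ - p - q ≤ 0 ∧ cubicWeight s ε ξ p q ≤ cubicConst s ε γ *
      (|α| + M) ^ (2 * γ) * ((ξ + |ξ - p - q|) * jap (ξ - p - q) ^ (-(1 + 2 * s)))) := by
  have hs : 0 ≤ s := hε.trans hεs
  have hq1 := one_le_jap q
  have hr1 := one_le_jap (ξ - p - q)
  have hw1 := one_le_jap (p - ξ)
  have hX1 := one_le_jap ξ
  have hq0 := jap_pos q
  have hr0 := jap_pos (ξ - p - q)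
  have hN1 : 1 ≤ |α| + M := by linarith [abs_nonneg α]
  have hNγ : 1 ≤ (|α| + M) ^ (2 * γ) := Real.one_le_rpow hN1 (by linarith)
  have hNγ0 : 0 < (|α| + M) ^ (2 * γ) := by linarith
  have hΦN : |Φbo ξ p q| ≤ |α| + M := by
    have := abs_sub_abs_le_abs_sub (Φbo ξ p q) α
    linarith
  have hξp : |ξ| ≤ |p| := by
    rw [abs_of_pos (by linarith), abs_of_pos (by linarith)]
    exact hp.le
  have hw : 0 < p - ξ := by linarith
  have nonres : ∀ G, 0 ≤ G → ξ * (p - ξ) ≤ |Φbo ξ p q| →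
      jap (p - ξ) ^ (2 * s) ≤
        2 ^ (2 * s) * G * (jap q ^ (2 * s + 2) * jap (ξ - p - q) ^ (2 * s)) →
      cubicWeight s ε ξ p q ≤ cubicConst s ε γ * (|α| + M) ^ (2 * γ) * (ξ * G) := by
    intro G hG hle h
    refine (cubicWeight_le_of_nonresonant hε hεs hγ0 hγ1 hγ2 hε1 hξ hp
      (by linarith : 1 + ξ * (p - ξ) ≤ 2 * (|α| + M)) h).trans ?_
    have : (2 : ℝ) ^ (2 * s + 2 * ε + 2) * 2 ^ (2 * γ) * 2 ^ (2 * s) ≤ cubicConst s ε γ := by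
      unfold cubicConst
      have : (0 : ℝ) < 4 ^ (2 * s + 2) := by positivity
      linarith
    gcongr
  have nonres_left : ξ * (p - ξ) ≤ |Φbo ξ p q| → jap (p - ξ) ≤ 2 * jap (ξ - p - q) →
      cubicWeight s ε ξ p q ≤
        cubicConst s ε γ * (|α| + M) ^ (2 * γ) * (ξ * jap q ^ (-(1 + 2 * s))) :=
    fun hle h => nonres _ (by positivity) hle (rpow_le_of_le_right_factor hs hq1 hr1 hw1 h)
  have nonres_right : ξ * (p - ξ) ≤ |Φbo ξ p q| → jap (p - ξ) ≤ 2 * jap q →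
      jap (ξ - p - q) ≤ jap q → cubicWeight s ε ξ p q ≤
        cubicConst s ε γ * (|α| + M) ^ (2 * γ) * (ξ * jap (ξ - p - q) ^ (-(1 + 2 * s))) :=
    fun hle h h' => nonres _ (by positivity) hle (rpow_le_of_le_left_factor hs hq1 hr1 hw1 h h')
  rcases le_total (ξ - p - q) 0 with hr | hr
  · rcases le_total q 0 with hq | hq
    · have hle : ξ * (p - ξ) ≤ |Φbo ξ p q| := by
        rw [Φbo_of_nonpos_of_nonpos (by linarith) (by linarith) hq hr]
        refine le_trans ?_ (neg_le_abs _)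
        nlinarith
      rcases le_total q (ξ - p - q) with h | h
      · refine Or.inr (Or.inl (nonres_right hle (jap_le_mul (by norm_num) ?_) (jap_le_jap ?_)))
        · rw [abs_of_pos hw, abs_of_nonpos hq]
          linarith
        · rw [abs_of_nonpos hr, abs_of_nonpos hq]
          linarith
      · refine Or.inl ⟨by linarith, hr, nonres_left hle (jap_le_mul (by norm_num) ?_)⟩
        rw [abs_of_pos hw, abs_of_nonpos hr]
        linarith
    · rcases le_total q (ξ / 4) with hq4 | hq4
      · refine Or.inl ⟨hq4, hr, ?_⟩
        rcases le_or_gt (ξ * (p - ξ)) |Φbo ξ p q| with hle | hlt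
        · refine nonres_left hle (jap_le_mul (by norm_num) ?_)
          rw [abs_of_pos hw, abs_of_nonpos hr]
          linarith
        · rw [Φbo_of_nonneg_of_nonpos (by linarith) (by linarith) hq hr] at hlt
          have hwq : ξ * (p - ξ) ≤ 4 * q ^ 2 := by
            have := neg_le_abs (2 * (q ^ 2 + (p - ξ) * q - ξ * (p - ξ)))
            nlinarith
          have hX2 : jap ξ ≤ 2 * ξ := by
            have := jap_le_one_add_abs ξ
            rw [abs_of_pos (by linarith)] at this
            linarith
          have hqr : jap q ≤ jap (ξ - p - q) := by
            apply jap_le_jap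
            rw [abs_of_nonneg hq, abs_of_nonpos hr]
            linarith
          have hqξ : jap q ≤ jap ξ := by
            apply jap_le_jap
            rw [abs_of_nonneg hq, abs_of_nonneg (by linarith)]
            linarith
          refine (cubicWeight_le (by linarith) (weight_le_of_resonant hε hεs hε1 hξ hX1 hX2 hp.le
            (jap_le_jap hξp) hq1 hqr hqξ hw.le (abs_le_jap q) hwq)).trans ?_
          have hK : 512 ≤ cubicConst s ε γ * (|α| + M) ^ (2 * γ) := by
            have : 512 ≤ cubicConst s ε γ := by
              unfold cubicConst
              have : (0 : ℝ) < 2 ^ (2 * s + 2 * ε + 2) * 2 ^ (2 * γ) * 2 ^ (2 * s) +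
                4 ^ (2 * s + 2) := by positivity
              linarith
            nlinarith
          gcongr
      · refine Or.inr (Or.inr ⟨hq, hr, ?_⟩)
        have hXq : jap ξ ≤ 4 * jap q := by
          apply jap_le_mul (by norm_num)
          rw [abs_of_nonneg hq, abs_of_nonneg (by linarith)]
          linarith
        refine (cubicWeight_le (by linarith) (weight_le_of_large hε hεs hX1 hq1 hr1
          (jap_le_jap hξp) hXq hw.le (by linarith))).trans ?_
        have hK : 4 ^ (2 * s + 2) ≤ cubicConst s ε γ * (|α| + M) ^ (2 * γ) := by
          have : 4 ^ (2 * s + 2) ≤ cubicConst s ε γ := by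
            unfold cubicConst
            have : (0 : ℝ) < 2 ^ (2 * s + 2 * ε + 2) * 2 ^ (2 * γ) * 2 ^ (2 * s) := by
              positivity
            linarith
          exact this.trans (le_mul_of_one_le_right (cubicConst_pos s ε γ).le hNγ)
        have hJ : jap (ξ - p - q) ≤ ξ + |ξ - p - q| :=
          (jap_le_one_add_abs _).trans (by linarith)
        have := cubicConst_pos s ε γ
        gcongr
  · have hq : q ≤ 0 := by linarith
    refine Or.inr (Or.inl (nonres_right ?_ (jap_le_mul (by norm_num) ?_) (jap_le_jap ?_)))
    · rw [Φbo_of_nonpos_of_nonneg (by linarith) (by linarith) hq hr]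
      refine le_trans ?_ (neg_le_abs _)
      nlinarith [sq_nonneg (p - ξ), sq_nonneg q, sq_nonneg (ξ - p - q)]
    · rw [abs_of_pos hw, abs_of_nonpos hq]
      linarith
    · rw [abs_of_nonneg hr, abs_of_nonpos hq]
      linarith

theorem mul_abs_self_monotone : Monotone fun x : ℝ => |x| * x := by
  intro x y h
  rcases le_total 0 x with hx | hx
  · have hy := hx.trans h
    simp only [abs_of_nonneg hx, abs_of_nonneg hy]
    gcongr
  · rcases le_total 0 y with hy | hy
    · simp only [abs_of_nonpos hx, abs_of_nonneg hy]
      nlinarith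
    · simp only [abs_of_nonpos hx, abs_of_nonpos hy]
      nlinarith

theorem mul_abs_sub_le_abs_Φbo_sub {ξ x y t : ℝ} (hξ : 0 < ξ) (hx : ξ < x) (hy : ξ < y) :
    ξ * |x - y| ≤ |Φbo ξ x (ξ - x - t) - Φbo ξ y (ξ - y - t)| := by
  wlog h : y ≤ x generalizing x y
  · rw [abs_sub_comm x y, abs_sub_comm (Φbo _ _ _)]
    exact this hy hx (le_of_not_ge h)
  have hm := mul_abs_self_monotone (by linarith : ξ - x - t ≤ ξ - y - t)
  rw [abs_of_nonneg (by linarith : 0 ≤ x - y)]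
  refine le_trans ?_ (neg_le_abs _)
  simp only [Φbo, sub_sub_cancel, abs_of_pos (hξ.trans hx), abs_of_pos (hξ.trans hy)] at hm ⊢
  nlinarith

theorem abs_sub_le_of_abs_sub_lt {a b α M : ℝ} (ha : |a - α| < M) (hb : |b - α| < M) :
    |a - b| ≤ 2 * M := by
  have := abs_sub_le a α b
  rw [abs_sub_comm α b] at this
  linarith

/-- Frequency-restricted estimate for the cubic resonance integral. -/
theorem cubic_resonance_integral_bound (s ε : ℝ) (hs : 0 < s) (hε0 : 0 ≤ ε)
    (hε : ε < min s (3 / 4)) (γ : ℝ)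
    (hγ : γ = max (max (1 / 4 + (ε - s) / 2) (ε - 1 / 2)) 0) :
    ∃ C : ℝ, 0 < C ∧ ∀ ξ α M : ℝ, 1 < ξ → 1 < M →
      (∫⁻ ξ₁ : ℝ, ∫⁻ ξ₂ : ℝ,
        ENNReal.ofReal (if ξ < ξ₁ ∧ |Φbo ξ ξ₁ ξ₂ - α| < M then
          jap ξ ^ (2 * s + 2 * ε + 2) * (ξ₂ + (ξ - ξ₁ - ξ₂)) ^ 2 /
            (ξ₁ ^ 2 * jap ξ₁ ^ (2 * s) * jap ξ₂ ^ (2 * s + 2) *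
              jap (ξ - ξ₁ - ξ₂) ^ (2 * s))
          else 0))
      ≤ ENNReal.ofReal (C * (|α| + M) ^ (2 * γ) * M) := by
  have hεs : ε ≤ s := (hε.trans_le (min_le_left _ _)).le
  have hε1 : ε ≤ 3 / 4 := (hε.trans_le (min_le_right _ _)).le
  have hγ0 : 0 ≤ γ := hγ ▸ le_max_right _ _
  have hγ1 : 2 * ε - 1 ≤ 2 * γ := by
    have : ε - 1 / 2 ≤ γ := hγ ▸ (le_max_right _ _).trans (le_max_left _ _)
    linarith
  have hγ2 : 2 * ε + 1 - 2 * s ≤ 4 * γ := by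
    have : 1 / 4 + (ε - s) / 2 ≤ γ := hγ ▸ (le_max_left _ _).trans (le_max_left _ _)
    linarith
  clear hγ
  set g : ℝ → ℝ := fun t => jap t ^ (-(1 + 2 * s))
  have hgm : Measurable g := continuous_jap.measurable.pow_const _
  have hg0 : ∀ t, 0 ≤ g t := fun t => (Real.rpow_pos_of_pos (jap_pos t) _).le
  set I := ∫⁻ t, ENNReal.ofReal (g t)
  have hIt : I ≠ ⊤ := (lintegral_jap_rpow_lt_top hs).ne
  have hK0 := cubicConst_pos s ε γ
  refine ⟨6 * cubicConst s ε γ * (I.toReal + 1), by positivity, fun ξ α M hξ hM => ?_⟩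
  have hξ0 : 0 < ξ := by linarith
  have hN0 : 0 < |α| + M := by linarith [abs_nonneg α]
  set K := cubicConst s ε γ * (|α| + M) ^ (2 * γ) with hK
  have hKpos : 0 < K := by positivity
  let S₁ : Set (ℝ × ℝ) :=
    {z | ξ < z.1 ∧ |Φbo ξ z.1 z.2 - α| < M ∧ z.2 ≤ ξ / 4 ∧ ξ - z.1 - z.2 ≤ 0}
  let S₂ : Set (ℝ × ℝ) := {z | ξ < z.1 ∧ |Φbo ξ z.1 (ξ - z.1 - z.2) - α| < M}
  let S₃ : Set (ℝ × ℝ) :=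
    {z | ξ < z.1 ∧ |Φbo ξ z.1 (ξ - z.1 - z.2) - α| < M ∧ 0 ≤ ξ - z.1 - z.2 ∧ z.2 ≤ 0}
  have hΦm : Measurable fun z : ℝ × ℝ => |Φbo ξ z.1 z.2 - α| :=
    (((continuous_Φbo ξ).sub continuous_const).abs).measurable
  have hΦm' : Measurable fun z : ℝ × ℝ => |Φbo ξ z.1 (ξ - z.1 - z.2) - α| :=
    hΦm.comp (by fun_prop : Measurable fun z : ℝ × ℝ => (z.1, ξ - z.1 - z.2))
  have hS₁ : MeasurableSet S₁ :=
    (measurableSet_lt measurable_const measurable_fst).inter <|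
      (measurableSet_lt hΦm measurable_const).inter <|
      (measurableSet_le measurable_snd measurable_const).inter <|
      measurableSet_le (by fun_prop : Measurable fun z : ℝ × ℝ => ξ - z.1 - z.2) measurable_const
  have hS₂ : MeasurableSet S₂ :=
    (measurableSet_lt measurable_const measurable_fst).inter <|
      measurableSet_lt hΦm' measurable_const
  have hS₃ : MeasurableSet S₃ :=
    (measurableSet_lt measurable_const measurable_fst).inter <|
      (measurableSet_lt hΦm' measurable_const).inter <|
      (measurableSet_le measurable_const
        (by fun_prop : Measurable fun z : ℝ × ℝ => ξ - z.1 - z.2)).inter <|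
      measurableSet_le measurable_snd measurable_const
  let H₁ : ℝ × ℝ → ℝ≥0∞ := S₁.indicator fun z => ENNReal.ofReal (ξ * g z.2)
  let H₂ : ℝ × ℝ → ℝ≥0∞ := S₂.indicator fun z => ENNReal.ofReal (ξ * g z.2)
  let H₃ : ℝ × ℝ → ℝ≥0∞ := S₃.indicator fun z => ENNReal.ofReal ((ξ + |z.2|) * g z.2)
  have hH₁ : Measurable H₁ := Measurable.indicator (by fun_prop) hS₁
  have hH₂ : Measurable H₂ := Measurable.indicator (by fun_prop) hS₂
  have hH₃ : Measurable H₃ := Measurable.indicator (by fun_prop) hS₃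
  have b₁ : ∫⁻ x : ℝ, ∫⁻ t : ℝ, H₁ (x, t) ≤ ENNReal.ofReal (2 * M) * I := by
    refine lintegral_indicator_le_of_sections hS₁ measurable_const hgm (fun _ => hξ0) hg0 ?_
    rintro x y t ⟨hx, hxΦ, ht, hxr⟩ ⟨hy, hyΦ, -, hyr⟩
    refine le_trans ?_ (abs_sub_le_of_abs_sub_lt hxΦ hyΦ)
    have e : Φbo ξ x t - Φbo ξ y t = -2 * (ξ - t) * (x - y) := by
      simp only [Φbo] at hxr hyr ⊢
      rw [abs_of_pos (hξ0.trans hx), abs_of_pos (hξ0.trans hy), abs_of_nonpos hxr,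
        abs_of_nonpos hyr]
      ring
    rw [e, abs_mul, abs_of_nonpos (by linarith : -2 * (ξ - t) ≤ 0)]
    gcongr
    linarith
  have b₂ : ∫⁻ x : ℝ, ∫⁻ t : ℝ, H₂ (x, t) ≤ ENNReal.ofReal (2 * M) * I := by
    refine lintegral_indicator_le_of_sections hS₂ measurable_const hgm (fun _ => hξ0) hg0 ?_
    rintro x y t ⟨hx, hxΦ⟩ ⟨hy, hyΦ⟩
    exact (mul_abs_sub_le_abs_Φbo_sub hξ0 hx hy).trans (abs_sub_le_of_abs_sub_lt hxΦ hyΦ)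
  have b₃ : ∫⁻ x : ℝ, ∫⁻ t : ℝ, H₃ (x, t) ≤ ENNReal.ofReal (2 * M) * I := by
    refine lintegral_indicator_le_of_sections hS₃ (D := fun t => ξ + |t|) (by fun_prop) hgm
      (fun _ => by positivity) hg0 ?_
    rintro x y t ⟨hx, hxΦ, hxq, ht⟩ ⟨hy, hyΦ, hyq, -⟩
    refine le_trans ?_ (abs_sub_le_of_abs_sub_lt hxΦ hyΦ)
    simp only at ht hxq hyq
    have e : Φbo ξ x (ξ - x - t) - Φbo ξ y (ξ - y - t) = -2 * (ξ - t) * (x - y) := by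
      simp only [Φbo, sub_sub_cancel]
      rw [abs_of_pos (hξ0.trans hx), abs_of_pos (hξ0.trans hy), abs_of_nonneg hxq,
        abs_of_nonneg hyq]
      ring
    rw [e, abs_mul, abs_of_nonpos (by linarith : -2 * (ξ - t) ≤ 0), abs_of_nonpos ht]
    gcongr
    linarith
  have key : ∀ p q : ℝ, ENNReal.ofReal (if ξ < p ∧ |Φbo ξ p q - α| < M then
      cubicWeight s ε ξ p q else 0) ≤ ENNReal.ofReal K *
        (H₁ (p, q) + H₂ (p, ξ - p - q) + H₃ (p, ξ - p - q)) := by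
    intro p q
    split_ifs with h
    · obtain ⟨hp, hΦ⟩ := h
      have hΦ' : |Φbo ξ p (ξ - p - (ξ - p - q)) - α| < M := by rwa [sub_sub_cancel]
      rcases cubicWeight_trichotomy hε0 hεs hγ0 hγ1 hγ2 hε1 hξ hM hp hΦ with
        ⟨h1, h2, h3⟩ | h3 | ⟨h1, h2, h3⟩
      · have hmem : (p, q) ∈ S₁ := ⟨hp, hΦ, h1, h2⟩
        have e : H₁ (p, q) = ENNReal.ofReal (ξ * g q) := Set.indicator_of_mem hmem _
        refine (ENNReal.ofReal_le_ofReal h3).trans ?_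
        rw [ENNReal.ofReal_mul hKpos.le]
        gcongr
        rw [← e, add_assoc]
        exact le_self_add
      · have hmem : (p, ξ - p - q) ∈ S₂ := ⟨hp, hΦ'⟩
        have e : H₂ (p, ξ - p - q) = ENNReal.ofReal (ξ * g (ξ - p - q)) :=
          Set.indicator_of_mem hmem _
        refine (ENNReal.ofReal_le_ofReal h3).trans ?_
        rw [ENNReal.ofReal_mul hKpos.le]
        gcongr
        rw [← e]
        exact le_add_self.trans le_self_add
      · have hmem : (p, ξ - p - q) ∈ S₃ := ⟨hp, hΦ', by simpa using h1, h2⟩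
        have e : H₃ (p, ξ - p - q) = ENNReal.ofReal ((ξ + |ξ - p - q|) * g (ξ - p - q)) :=
          Set.indicator_of_mem hmem _
        refine (ENNReal.ofReal_le_ofReal h3).trans ?_
        rw [ENNReal.ofReal_mul hKpos.le]
        gcongr
        rw [← e]
        exact le_add_self
    · simp
  have inner : ∀ p : ℝ, ∫⁻ q : ℝ, (H₁ (p, q) + H₂ (p, ξ - p - q) + H₃ (p, ξ - p - q)) =
      (∫⁻ t, H₁ (p, t)) + (∫⁻ t, H₂ (p, t)) + ∫⁻ t, H₃ (p, t) := by
    intro p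
    have hr : Measurable fun q : ℝ => (p, ξ - p - q) := by fun_prop
    have m₂ : Measurable fun q => H₂ (p, ξ - p - q) := hH₂.comp hr
    have m₃ : Measurable fun q => H₃ (p, ξ - p - q) := hH₃.comp hr
    rw [lintegral_add_right _ m₃, lintegral_add_right _ m₂,
      lintegral_sub_left_eq_self (fun t => H₂ (p, t)) (ξ - p),
      lintegral_sub_left_eq_self (fun t => H₃ (p, t)) (ξ - p)]
  calc _ ≤ ∫⁻ p : ℝ, ∫⁻ q : ℝ, ENNReal.ofReal K *
          (H₁ (p, q) + H₂ (p, ξ - p - q) + H₃ (p, ξ - p - q)) :=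
        lintegral_mono fun p => lintegral_mono fun q => key p q
    _ = ENNReal.ofReal K * ((∫⁻ p : ℝ, ∫⁻ t : ℝ, H₁ (p, t)) + (∫⁻ p : ℝ, ∫⁻ t : ℝ, H₂ (p, t)) +
          ∫⁻ p : ℝ, ∫⁻ t : ℝ, H₃ (p, t)) := by
        simp_rw [lintegral_const_mul' _ _ ENNReal.ofReal_ne_top, inner]
        rw [lintegral_add_right _ hH₃.lintegral_prod_right',
          lintegral_add_right _ hH₂.lintegral_prod_right']
    _ ≤ ENNReal.ofReal K * (ENNReal.ofReal (2 * M) * I + ENNReal.ofReal (2 * M) * I +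
          ENNReal.ofReal (2 * M) * I) := by gcongr
    _ = ENNReal.ofReal (6 * K * I.toReal * M) := by
        rw [← ENNReal.ofReal_toReal hIt, ← ENNReal.ofReal_mul (by linarith),
          ← ENNReal.ofReal_add (by positivity) (by positivity),
          ← ENNReal.ofReal_add (by positivity) (by positivity), ← ENNReal.ofReal_mul hKpos.le,
          ENNReal.toReal_ofReal ENNReal.toReal_nonneg]
        congr 1
        ring
    _ ≤ _ := by
        apply ENNReal.ofReal_le_ofReal
        have : 0 ≤ 6 * K * M := by positivity
        calc 6 * K * I.toReal * M ≤ 6 * K * I.toReal * M + 6 * K * M := by linarith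
          _ = _ := by rw [hK]; ring
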